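/- arXiv:1207.6503 — 2 statements merged into one kernel-verified Lean document; each statement's English description precedes it below -/
import Mathlib

section
/- Suppose the families U(2^m), V(2^m), F(2^m) satisfy conditions (1)–(8) at every index m ≥ 1. Let α ≥ 1 have binary expansion α = 2^{p_1} + ⋯ + 2^{p_t}, suppose some p_i lies in S, and let m be the largest element k of Y for which some p_i lies in S_k. Then dim_K V^>(α) < 2α · ∏_{i∈Y, i≤m} 2^{2^{e(i)+1}}. -/
/-
Formalization of statements from:
"Golod-Shafarevich algebras of a reduced number of defining relations" (A. Smoktunowicz).

`FA K` is the free associative unital `K`-algebra `A = K⟨x,y⟩` on two generators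
(`FreeAlgebra.ι K 0` and `FreeAlgebra.ι K 1`), graded with the generators in degree 1.
-/

open scoped Pointwise Classical

noncomputable section

/-- The free associative unital `K`-algebra on two generators. -/
abbrev FA (K : Type) [Field K] : Type := FreeAlgebra K (Fin 2)

variable (K : Type) [Field K]

/-- The set of monomials of degree `k` in the free algebra on two generators. -/
def Mon (k : ℕ) : Set (FA K) :=
  { m | ∃ w : List (Fin 2), w.length = k ∧ m = (w.map (FreeAlgebra.ι K)).prod }

/-- `Adeg K k` is the `k`-th homogeneous component `A(k)`: the span of the monomials of
degree `k`. -/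
def Adeg (k : ℕ) : Submodule K (FA K) :=
  Submodule.span K (Mon K k)

/-- Properties (1)-(4) of the families `U(2^m)`, `V(2^m)` of subspaces of `A(2^m)`
(Section 1 of the paper):
(1) `V(2^m)` is spanned by monomials (of degree `2^m`);
(2) `V(2^m) + U(2^m) = A(2^m)` and `V(2^m) ∩ U(2^m) = 0`;
(3) `A(2^{m-1})U(2^{m-1}) + U(2^{m-1})A(2^{m-1}) ⊆ U(2^m)`;
(4) `V(2^m) ⊆ V(2^{m-1})V(2^{m-1})`;
with `V(2^0) = Kx + Ky` and `U(2^0) = 0`. -/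
def UVCond (U V : ℕ → Submodule K (FA K)) : Prop :=
  V 0 = Submodule.span K {FreeAlgebra.ι K 0, FreeAlgebra.ι K 1} ∧
  U 0 = ⊥ ∧
  ∀ m : ℕ, 1 ≤ m →
    (∃ s ⊆ Mon K (2 ^ m), V m = Submodule.span K s) ∧
    U m ≤ Adeg K (2 ^ m) ∧
    V m ⊔ U m = Adeg K (2 ^ m) ∧
    V m ⊓ U m = ⊥ ∧
    Adeg K (2 ^ (m - 1)) * U (m - 1) ⊔ U (m - 1) * Adeg K (2 ^ (m - 1)) ≤ U m ∧
    V m ≤ V (m - 1) * V (m - 1)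

/-- The homogeneous component `E(k)` (as a set), for `k ≥ 1`.  For the unique `n` with
`2^(n-1) ≤ k < 2^n` (i.e. `n = Nat.log 2 k + 1`) it consists of those `r ∈ A(k)` with
`A r A ∩ A(2^(n+1)) ⊆ U(2^n)A(2^n) + A(2^n)U(2^n)`; here `A r A` is the two-sided ideal
generated by `r`, realized as the subspace `⊤ * span{r} * ⊤`. -/
def ESet (U : ℕ → Submodule K (FA K)) (k : ℕ) : Set (FA K) :=
  { r | r ∈ Adeg K k ∧
    (⊤ : Submodule K (FA K)) * Submodule.span K {r} * ⊤ ⊓ Adeg K (2 ^ (Nat.log 2 k + 2)) ≤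
      U (Nat.log 2 k + 1) * Adeg K (2 ^ (Nat.log 2 k + 1)) ⊔
        Adeg K (2 ^ (Nat.log 2 k + 1)) * U (Nat.log 2 k + 1) }

/-- The graded subspace `E = ⊕_{k ≥ 1} E(k)` (each `E(k)` is a subspace, so the span of the
union of the `E(k)` is their direct sum). -/
def Esub (U : ℕ → Submodule K (FA K)) : Submodule K (FA K) :=
  Submodule.span K (⋃ k ∈ Set.Ici 1, ESet K U k)

/-- Auxiliary: the product of the `V(2^p)` over the set bits of `k`, lowest bit first,
with bit positions shifted by `i`. -/
def prodLow (V : ℕ → Submodule K (FA K)) (i k : ℕ) : Submodule K (FA K) :=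
  if _h : k = 0 then 1
  else (if k % 2 = 1 then V i else 1) * prodLow V (i + 1) (k / 2)
termination_by k
decreasing_by exact Nat.div_lt_self (Nat.pos_of_ne_zero _h) one_lt_two

/-- Auxiliary: the product of the `V(2^p)` over the set bits of `k`, highest bit first. -/
def prodHigh (V : ℕ → Submodule K (FA K)) (i k : ℕ) : Submodule K (FA K) :=
  if _h : k = 0 then 1
  else prodHigh V (i + 1) (k / 2) * (if k % 2 = 1 then V i else 1)
termination_by k
decreasing_by exact Nat.div_lt_self (Nat.pos_of_ne_zero _h) one_lt_two

/-- `V^<(k) = V(2^{p_1}) ⋯ V(2^{p_t})` where `k = 2^{p_1} + ⋯ + 2^{p_t}` in binary with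
`p_1 < ⋯ < p_t`; `V^<(0) = K·1`. -/
def Vlt (V : ℕ → Submodule K (FA K)) (k : ℕ) : Submodule K (FA K) := prodLow K V 0 k

/-- `V^>(k) = V(2^{p_t}) ⋯ V(2^{p_1})`; `V^>(0) = K·1`. -/
def Vgt (V : ℕ → Submodule K (FA K)) (k : ℕ) : Submodule K (FA K) := prodHigh K V 0 k

/-- `U^<(k) = Σ_i A(2^{p_1}+⋯+2^{p_{i-1}}) U(2^{p_i}) A(2^{p_{i+1}}+⋯+2^{p_t})`
(for each set bit `p_i` of `k`, the lower part of `k` is `k % 2^{p_i}` and the upper part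
is `k - k % 2^{p_i} - 2^{p_i}`); `U^<(0) = 0`. -/
def Ult (U : ℕ → Submodule K (FA K)) (k : ℕ) : Submodule K (FA K) :=
  ⨆ (p : ℕ) (_ : k.testBit p),
    Adeg K (k % 2 ^ p) * U p * Adeg K (k - k % 2 ^ p - 2 ^ p)

/-- `U^>(k) = Σ_i A(2^{p_t}+⋯+2^{p_{i+1}}) U(2^{p_i}) A(2^{p_{i-1}}+⋯+2^{p_1})`;
`U^>(0) = 0`. -/
def Ugt (U : ℕ → Submodule K (FA K)) (k : ℕ) : Submodule K (FA K) :=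
  ⨆ (p : ℕ) (_ : k.testBit p),
    Adeg K (k - k % 2 ^ p - 2 ^ p) * U p * Adeg K (k % 2 ^ p)

/-- The Capelli polynomial
`d_n(x_1,…,x_n; y_1,…,y_n) = Σ_{σ ∈ Sym(n)} sgn(σ) x_{σ(1)} y_1 x_{σ(2)} y_2 ⋯ x_{σ(n)} y_n`,
evaluated in a ring. -/
def capelli {R : Type*} [Ring R] (n : ℕ) (x y : Fin n → R) : R :=
  ∑ σ : Equiv.Perm (Fin n),
    (Equiv.Perm.sign σ : ℤ) • ((List.finRange n).map fun i => x (σ i) * y i).prod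

/-- The quotient map `R → R ⧸ c` (for a ring congruence `c`) as a `K`-linear map. -/
def mkLin {R : Type*} [Semiring R] [Algebra K R] (c : RingCon R) :
    R →ₗ[K] c.Quotient where
  toFun := RingCon.toQuotient
  map_add' _ _ := rfl
  map_smul' _ _ := rfl

/-- A two-sided ideal of the free algebra is homogeneous iff it is spanned by its
homogeneous elements. -/
def IsHomogTSI (J : TwoSidedIdeal (FA K)) : Prop :=
  (J : Set (FA K)) ⊆ ↑(Submodule.span K {a : FA K | a ∈ J ∧ ∃ n, a ∈ Adeg K n})

/-- `S = ⋃_{n ∈ Y} {n - e(n) - 1, …, n - 1}`. -/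
def SetS (Y : Set ℕ) (e : ℕ → ℕ) : Set ℕ :=
  ⋃ n ∈ Y, Set.Icc (n - e n - 1) (n - 1)

/-- Conditions (1)-(8) of Theorem 4.1 of the paper, at index `m`, for the families
`F(2^m)`, `U(2^m)`, `V(2^m)` of subspaces of `A(2^m)`:
(1) `dim V(2^m) = 2` if `m ∉ S` and (in case `Y` is finite) `m ≤ max Y`;
(2) `dim V(2^{k-e(k)-1+j}) = 2^{2^j}` for all `k ∈ Y` and `0 ≤ j ≤ e(k)`;
(3) `V(2^m)` is spanned by monomials;
(4) `F(2^m) ⊆ U(2^m)` for `m ∈ Y`, and `F(2^m) = 0` for `m ∉ Y`;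
(5) `V(2^m) ⊕ U(2^m) = A(2^m)`;
(6) `A(2^{m-1})U(2^{m-1}) + U(2^{m-1})A(2^{m-1}) ⊆ U(2^m)`;
(7) `V(2^m) ⊆ V(2^{m-1})V(2^{m-1})`;
(8) if `Y` is finite and `m > max Y`, then `dim V(2^m) = 1`. -/
def Conds (Y : Set ℕ) (e : ℕ → ℕ) (F U V : ℕ → Submodule K (FA K)) (m : ℕ) : Prop :=
  (m ∉ SetS Y e → (Y.Finite → ∃ k ∈ Y, m ≤ k) → Module.finrank K (V m) = 2) ∧
  (∀ k ∈ Y, ∀ j ≤ e k, k - e k - 1 + j = m → Module.finrank K (V m) = 2 ^ 2 ^ j) ∧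
  (∃ s ⊆ Mon K (2 ^ m), V m = Submodule.span K s) ∧
  (m ∈ Y → F m ≤ U m) ∧ (m ∉ Y → F m = ⊥) ∧
  U m ≤ Adeg K (2 ^ m) ∧
  V m ⊔ U m = Adeg K (2 ^ m) ∧ V m ⊓ U m = ⊥ ∧
  (Adeg K (2 ^ (m - 1)) * U (m - 1) ⊔ U (m - 1) * Adeg K (2 ^ (m - 1)) ≤ U m) ∧
  V m ≤ V (m - 1) * V (m - 1) ∧
  (Y.Finite → (∀ k ∈ Y, k < m) → Module.finrank K (V m) = 1)

open Finset in
lemma prod_range_two_pow_two_pow_le (n : ℕ) : ∏ j ∈ range n, 2 ^ 2 ^ j ≤ 2 ^ 2 ^ n := by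
  induction n with
  | zero => simp
  | succ n ih =>
    rw [prod_range_succ, pow_succ 2 n, mul_two, pow_add]
    exact Nat.mul_le_mul_right _ ih

lemma Submodule.rank_mul_le_mul_rank {K A : Type} [Field K] [Ring A] [Algebra K A]
    (M N : Submodule K A) :
    Module.rank K (M * N : Submodule K A) ≤ Module.rank K M * Module.rank K N := by
  rw [← Submodule.mulMap_range, ← rank_tensorProduct']
  exact rank_range_le _

variable {K}

lemma rank_prodHigh_le (V : ℕ → Submodule K (FA K)) (d : ℕ → ℕ)
    (hd : ∀ p, Module.rank K (V p) ≤ d p) (n : ℕ) :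
    ∀ i k, k < 2 ^ n → Module.rank K (prodHigh K V i k) ≤
      ((∏ p ∈ Finset.range n, if k.testBit p then d (p + i) else 1 : ℕ) : Cardinal) := by
  have rank_one_le : Module.rank K (1 : Submodule K (FA K)) ≤ 1 := by
    rw [Submodule.one_eq_span]
    exact (rank_span_le _).trans (by simp)
  induction n with
  | zero =>
    intro i k hk
    obtain rfl : k = 0 := by simpa using hk
    rw [prodHigh]
    simpa using rank_one_le
  | succ n ih =>
    intro i k hk
    rw [prodHigh]
    by_cases h0 : k = 0
    · subst h0
      simpa using rank_one_le
    rw [dif_neg h0, Finset.prod_range_succ', Nat.cast_mul]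
    refine (Submodule.rank_mul_le_mul_rank _ _).trans (mul_le_mul' ?_ ?_)
    · have := ih (i + 1) (k / 2) (by omega)
      simpa [Nat.testBit_succ, add_assoc, add_comm 1 i] using this
    · by_cases hodd : k % 2 = 1
      · rw [if_pos hodd]
        simpa [Nat.testBit_zero, hodd] using hd i
      · rw [if_neg hodd]
        simpa [Nat.testBit_zero, hodd] using rank_one_le

section Dimensions

variable {Y : Set ℕ} {e : ℕ → ℕ} {F U V : ℕ → Submodule K (FA K)}

lemma finrank_V_zero (hV0 : V 0 = Submodule.span K {FreeAlgebra.ι K 0, FreeAlgebra.ι K 1}) :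
    Module.finrank K (V 0) = 2 := by
  have hli : LinearIndependent K (FreeAlgebra.ι K : Fin 2 → FA K) := by
    have h := (FreeAlgebra.basisFreeMonoid K (Fin 2)).linearIndependent.comp
      FreeMonoid.of FreeMonoid.of_injective
    have heq : (FreeAlgebra.basisFreeMonoid K (Fin 2) : FreeMonoid (Fin 2) → FA K) ∘
        FreeMonoid.of = FreeAlgebra.ι K := by
      ext i
      simp [FreeAlgebra.basisFreeMonoid, FreeAlgebra.equivMonoidAlgebraFreeMonoid]
    rwa [heq] at h
  have hset : ({FreeAlgebra.ι K 0, FreeAlgebra.ι K 1} : Set (FA K))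
      = Set.range (FreeAlgebra.ι K : Fin 2 → FA K) := by
    ext; simp [eq_comm]
  rw [hV0, hset, finrank_span_eq_card hli]
  simp

lemma succ_le_of_conds (hY : ∀ n ∈ Y, 1 ≤ n)
    (hdisj : ∀ n ∈ Y, ∀ m ∈ Y, n ≠ m →
      Disjoint (Set.Icc (n - e n - 1) (n - 1)) (Set.Icc (m - e m - 1) (m - 1)))
    (hconds : ∀ m, 1 ≤ m → Conds K Y e F U V m) {k : ℕ} (hk : k ∈ Y) :
    e k + 1 ≤ k := by
  by_contra! hlt
  have hk1 := hY k hk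
  obtain ⟨h1, h2, -⟩ := hconds k hk1
  have hbig := h2 k hk k (by omega) (by omega)
  have hne : (2 : ℕ) ^ 2 ^ k ≠ 2 := fun h => by
    have h' : (2 : ℕ) ^ k = 1 := Nat.pow_right_injective le_rfl (by simpa using h)
    have := Nat.one_lt_two_pow (n := k) (by omega)
    omega
  by_cases hS : k ∈ SetS Y e
  · simp only [SetS, Set.mem_iUnion, Set.mem_Icc, exists_prop] at hS
    obtain ⟨k', hk', hle, hge⟩ := hS
    have hnek : k ≠ k' := by rintro rfl; omega
    have hnot := Set.disjoint_right.1 (hdisj k hk k' hk' hnek)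
      (Set.left_mem_Icc.2 (by omega))
    rw [Set.mem_Icc] at hnot
    have := h2 k' hk' 0 (by omega) (by omega)
    exact hne (by rw [← hbig, this]; norm_num)
  · exact hne (hbig.symm.trans (h1 hS fun _ => ⟨k, hk, le_rfl⟩))

lemma finrank_V_eq_of_mem
    (hV0 : V 0 = Submodule.span K {FreeAlgebra.ι K 0, FreeAlgebra.ι K 1})
    (hconds : ∀ m, 1 ≤ m → Conds K Y e F U V m) {k : ℕ} (hk : k ∈ Y) {j : ℕ} (hj : j ≤ e k) :
    Module.finrank K (V (k - e k - 1 + j)) = 2 ^ 2 ^ j := by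
  rcases Nat.eq_zero_or_pos (k - e k - 1 + j) with h | h
  · obtain rfl : j = 0 := by omega
    rw [h, finrank_V_zero hV0]
    norm_num
  · exact (hconds _ h).2.1 k hk j hj rfl

lemma finrank_V_of_notMem
    (hV0 : V 0 = Submodule.span K {FreeAlgebra.ι K 0, FreeAlgebra.ι K 1})
    (hconds : ∀ m, 1 ≤ m → Conds K Y e F U V m) {p : ℕ} (hp : p ∉ SetS Y e) :
    0 < Module.finrank K (V p) ∧ Module.finrank K (V p) ≤ 2 := by
  rcases Nat.eq_zero_or_pos p with rfl | h
  · simp [finrank_V_zero hV0]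
  obtain ⟨h1, -, -, -, -, -, -, -, -, -, h8⟩ := hconds p h
  by_cases hb : Y.Finite → ∃ k ∈ Y, p ≤ k
  · simp [h1 hp hb]
  · push Not at hb
    simp [h8 hb.1 hb.2]

lemma finrank_V_pos (hY : ∀ n ∈ Y, 1 ≤ n)
    (hdisj : ∀ n ∈ Y, ∀ m ∈ Y, n ≠ m →
      Disjoint (Set.Icc (n - e n - 1) (n - 1)) (Set.Icc (m - e m - 1) (m - 1)))
    (hV0 : V 0 = Submodule.span K {FreeAlgebra.ι K 0, FreeAlgebra.ι K 1})
    (hconds : ∀ m, 1 ≤ m → Conds K Y e F U V m) (p : ℕ) :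
    0 < Module.finrank K (V p) := by
  by_cases hS : p ∈ SetS Y e
  · simp only [SetS, Set.mem_iUnion, Set.mem_Icc, exists_prop] at hS
    obtain ⟨k, hk, hle, hge⟩ := hS
    have hek := succ_le_of_conds hY hdisj hconds hk
    have := finrank_V_eq_of_mem hV0 hconds hk (j := p - (k - e k - 1)) (by omega)
    rw [Nat.add_sub_cancel' hle] at this
    rw [this]
    positivity
  · exact (finrank_V_of_notMem hV0 hconds hS).1

lemma prod_Icc_finrank_V_le (hY : ∀ n ∈ Y, 1 ≤ n)
    (hdisj : ∀ n ∈ Y, ∀ m ∈ Y, n ≠ m →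
      Disjoint (Set.Icc (n - e n - 1) (n - 1)) (Set.Icc (m - e m - 1) (m - 1)))
    (hV0 : V 0 = Submodule.span K {FreeAlgebra.ι K 0, FreeAlgebra.ι K 1})
    (hconds : ∀ m, 1 ≤ m → Conds K Y e F U V m) {k : ℕ} (hk : k ∈ Y) :
    ∏ p ∈ Finset.Icc (k - e k - 1) (k - 1), Module.finrank K (V p) ≤ 2 ^ 2 ^ (e k + 1) := by
  have hek := succ_le_of_conds hY hdisj hconds hk
  have hIcc : Finset.Icc (k - e k - 1) (k - 1)
      = Finset.Ico (k - e k - 1) (k - e k - 1 + (e k + 1)) := by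
    ext; simp only [Finset.mem_Icc, Finset.mem_Ico]; omega
  rw [hIcc, Finset.prod_Ico_eq_prod_range, Nat.add_sub_cancel_left]
  refine le_trans (le_of_eq (Finset.prod_congr rfl fun j hj => ?_))
    (prod_range_two_pow_two_pow_le _)
  exact finrank_V_eq_of_mem hV0 hconds hk (by simpa [Nat.lt_succ_iff] using hj)

end Dimensions

variable (K)

/-- **Proposition 5.3.**  If some binary digit of `α` lies in `S` and `m` is the largest
element of `Y` with a digit of `α` in `S_m`, then
`dim V^>(α) < 2α · ∏_{i∈Y, i≤m} 2^{2^{e(i)+1}}`. -/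
theorem statement15 (Y : Set ℕ) (hY : ∀ n ∈ Y, 1 ≤ n) (e : ℕ → ℕ) (he : ∀ n ∈ Y, 1 ≤ e n)
    (hdisj : ∀ n ∈ Y, ∀ m ∈ Y, n ≠ m →
      Disjoint (Set.Icc (n - e n - 1) (n - 1)) (Set.Icc (m - e m - 1) (m - 1)))
    (F U V : ℕ → Submodule K (FA K))
    (hV0 : V 0 = Submodule.span K {FreeAlgebra.ι K 0, FreeAlgebra.ι K 1})
    (hU0 : U 0 = ⊥)
    (hconds : ∀ m, 1 ≤ m → Conds K Y e F U V m)
    (α : ℕ) (hα : 1 ≤ α)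
    (m : ℕ) (hm : m ∈ Y)
    (hm₁ : ∃ p, α.testBit p ∧ p ∈ Set.Icc (m - e m - 1) (m - 1))
    (hm₂ : ∀ k ∈ Y, (∃ p, α.testBit p ∧ p ∈ Set.Icc (k - e k - 1) (k - 1)) → k ≤ m) :
    Module.rank K (Vgt K V α) <
      ((2 * α * ∏ i ∈ Finset.range (m + 1), if i ∈ Y then 2 ^ 2 ^ (e i + 1) else 1 : ℕ) :
        Cardinal) := by
  set d : ℕ → ℕ := fun p => Module.finrank K (V p) with hd
  have hdpos : ∀ p, 0 < d p := finrank_V_pos hY hdisj hV0 hconds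
  have hrank : ∀ p, Module.rank K (V p) ≤ d p := fun p => by
    have := Module.finite_of_finrank_pos (hdpos p)
    exact (Module.finrank_eq_rank K (V p)).ge
  set n := Nat.log 2 α with hn
  have hlt : α < 2 ^ (n + 1) := Nat.lt_pow_succ_log_self one_lt_two α
  have hle : 2 ^ n ≤ α := Nat.pow_log_le_self 2 (by omega)
  refine (rank_prodHigh_le V d hrank (n + 1) 0 α hlt).trans_lt (Nat.cast_lt.2 ?_)
  simp only [add_zero]
  rw [← Finset.prod_filter, ← Finset.prod_filter]
  set B := (Finset.range (n + 1)).filter fun p => α.testBit p with hB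
  set I := (Finset.range (m + 1)).filter fun i => i ∈ Y with hI
  rw [← Finset.prod_filter_not_mul_prod_filter B (· ∈ SetS Y e)]
  have hout : ∏ p ∈ B with p ∉ SetS Y e, d p ≤ 2 ^ n := by
    refine (Finset.prod_le_pow_card _ _ 2 fun p hp => ?_).trans
      (Nat.pow_le_pow_right two_pos ?_)
    · exact (finrank_V_of_notMem hV0 hconds (Finset.mem_filter.1 hp).2).2
    · obtain ⟨p, hpα, hpm⟩ := hm₁
      have hpn : p < n + 1 :=
        (Nat.pow_lt_pow_iff_right one_lt_two).1 ((Nat.ge_two_pow_of_testBit hpα).trans_lt hlt)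
      have hpS : p ∈ SetS Y e := Set.mem_biUnion hm hpm
      have hss : (B.filter fun p => p ∉ SetS Y e) ⊂ Finset.range (n + 1) := by
        refine (Finset.ssubset_iff_of_subset
          ((Finset.filter_subset _ _).trans (Finset.filter_subset _ _))).2
          ⟨p, Finset.mem_range.2 hpn, fun h => (Finset.mem_filter.1 h).2 hpS⟩
      have := Finset.card_lt_card hss
      rw [Finset.card_range] at this
      omega
  have hin : ∏ p ∈ B with p ∈ SetS Y e, d p ≤ ∏ i ∈ I, 2 ^ 2 ^ (e i + 1) := by
    calc ∏ p ∈ B with p ∈ SetS Y e, d p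
        ≤ ∏ p ∈ I.biUnion fun k => Finset.Icc (k - e k - 1) (k - 1), d p := by
          refine Finset.prod_le_prod_of_subset_of_one_le' (fun p hp => ?_)
            fun p _ _ => hdpos p
          simp only [hB, Finset.mem_filter, SetS, Set.mem_iUnion, exists_prop] at hp
          obtain ⟨⟨-, hpα⟩, k, hk, hpk⟩ := hp
          simp only [hI, Finset.mem_biUnion, Finset.mem_filter, Finset.mem_range]
          exact ⟨k, ⟨Nat.lt_succ_of_le (hm₂ k hk ⟨p, hpα, hpk⟩), hk⟩,
            Finset.mem_Icc.2 hpk⟩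
      _ = ∏ k ∈ I, ∏ p ∈ Finset.Icc (k - e k - 1) (k - 1), d p := by
          refine Finset.prod_biUnion fun i hi j hj hij => ?_
          have := hdisj i (Finset.mem_filter.1 hi).2 j (Finset.mem_filter.1 hj).2 hij
          simpa [← Finset.coe_Icc, Finset.disjoint_coe] using this
      _ ≤ ∏ i ∈ I, 2 ^ 2 ^ (e i + 1) :=
          Finset.prod_le_prod' fun k hk =>
            prod_Icc_finrank_V_le hY hdisj hV0 hconds (Finset.mem_filter.1 hk).2
  have hpos : 0 < ∏ i ∈ I, 2 ^ 2 ^ (e i + 1) := Finset.prod_pos fun _ _ => by positivity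
  exact (Nat.mul_le_mul (hout.trans hle) hin).trans_lt
    (Nat.mul_lt_mul_of_pos_right (by omega) hpos)

end
end

section
/- Let n ∈ Y, and suppose that for every m < n the subspaces U(2^m), V(2^m) (together with subspaces F(2^m)) satisfy conditions (1)–(8) at every index m < n. Then there exists a K-subspace F'(2^n) ⊆ A(2^n) such that 0 < dim_K F'(2^n) ≤ (1/2)·(dim_K V(2^{n−1}))^2, and such that for every f among f_1, …, f_ξ with k := deg f satisfying 2^n + 2^{n−1} ≤ k ≤ 2^n + 2^{n−1} + 2^{n−2}, and for all i, j ≥ 0 with i + j = k − 2^n, one has f ∈ A(i)F'(2^n)A(j) + U^<(i)A(k−i) + A(k−j)U^>(j). -/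
/-
Formalization of statements from:
"Golod-Shafarevich algebras of a reduced number of defining relations" (A. Smoktunowicz).

`FA K` is the free associative unital `K`-algebra `A = K⟨x,y⟩` on two generators
(`FreeAlgebra.ι K 0` and `FreeAlgebra.ι K 1`), graded with the generators in degree 1.
-/

open scoped Pointwise Classical

noncomputable section

variable (K : Type) [Field K]

/-- The submodule product of two finite-dimensional subspaces is finite-dimensional, of dimension
at most the product of the dimensions. -/
theorem finite_and_finrank_mul_le {R : Type*} [Ring R] [Algebra K R] (W W' : Submodule K R)
    [FiniteDimensional K W] [FiniteDimensional K W'] :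
    FiniteDimensional K ↥(W * W') ∧
      Module.finrank K ↥(W * W') ≤ Module.finrank K W * Module.finrank K W' := by
  set b := Module.finBasis K W
  set c := Module.finBasis K W'
  have h1 : W = Submodule.span K (Set.range fun i => (b i : R)) := by
    have := congrArg (Submodule.map W.subtype) b.span_eq
    rw [Submodule.map_span, Submodule.map_top, Submodule.range_subtype, ← Set.range_comp] at this
    exact this.symm
  have h2 : W' = Submodule.span K (Set.range fun i => (c i : R)) := by
    have := congrArg (Submodule.map W'.subtype) c.span_eq
    rw [Submodule.map_span, Submodule.map_top, Submodule.range_subtype, ← Set.range_comp] at this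
    exact this.symm
  have h3 : W * W' = Submodule.span K (Set.range fun p : _ × _ => (b p.1 : R) * (c p.2 : R)) := by
    conv_lhs => rw [h1, h2, Submodule.span_mul_span]
    congr 1
    ext z
    simp [Set.mem_mul]
  rw [h3]
  refine ⟨FiniteDimensional.span_of_finite K (Set.finite_range _), ?_⟩
  refine (finrank_range_le_card _).trans ?_
  simp

/-- An element of `W * M`, with `W` finite-dimensional, involves only `dim W` elements of `M`. -/
theorem exists_eq_sum_finBasis_mul {R : Type*} [Ring R] [Algebra K R] (W M : Submodule K R)
    [FiniteDimensional K W] {z : R} (hz : z ∈ W * M) :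
    ∃ m : Fin (Module.finrank K W) → R, (∀ a, m a ∈ M) ∧
      z = ∑ a, (Module.finBasis K W a : R) * m a := by
  induction hz using Submodule.mul_induction_on' with
  | mem_mul_mem w hw m hm =>
    refine ⟨fun a => (Module.finBasis K W).repr ⟨w, hw⟩ a • m,
      fun a => M.smul_mem _ hm, ?_⟩
    have := congrArg (W.subtype) ((Module.finBasis K W).sum_repr ⟨w, hw⟩)
    simp only [map_sum, map_smul, Submodule.subtype_apply] at this
    conv_lhs => rw [← this]
    simp [Finset.sum_mul]
  | add z _ z' _ h h' =>
    obtain ⟨m, hm, rfl⟩ := h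
    obtain ⟨m', hm', rfl⟩ := h'
    exact ⟨fun a => m a + m' a, fun a => M.add_mem (hm a) (hm' a), by
      simp [mul_add, Finset.sum_add_distrib]⟩

/-- The mirror image of `exists_eq_sum_finBasis_mul`. -/
theorem exists_eq_sum_mul_finBasis {R : Type*} [Ring R] [Algebra K R] (M W : Submodule K R)
    [FiniteDimensional K W] {z : R} (hz : z ∈ M * W) :
    ∃ m : Fin (Module.finrank K W) → R, (∀ a, m a ∈ M) ∧
      z = ∑ a, m a * (Module.finBasis K W a : R) := by
  induction hz using Submodule.mul_induction_on' with
  | mem_mul_mem m hm w hw =>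
    refine ⟨fun a => (Module.finBasis K W).repr ⟨w, hw⟩ a • m,
      fun a => M.smul_mem _ hm, ?_⟩
    have := congrArg (W.subtype) ((Module.finBasis K W).sum_repr ⟨w, hw⟩)
    simp only [map_sum, map_smul, Submodule.subtype_apply] at this
    conv_lhs => rw [← this]
    simp [Finset.mul_sum]
  | add z _ z' _ h h' =>
    obtain ⟨m, hm, rfl⟩ := h
    obtain ⟨m', hm', rfl⟩ := h'
    exact ⟨fun a => m a + m' a, fun a => M.add_mem (hm a) (hm' a), by
      simp [add_mul, Finset.sum_add_distrib]⟩

/-- An element of `W * M * W'` already lies in `W * G * W'` for some `G ≤ M` of dimension at most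
`dim W * dim W'`. -/
theorem exists_le_finrank_le_mem_mul_mul {R : Type*} [Ring R] [Algebra K R]
    (W M W' : Submodule K R) [FiniteDimensional K W] [FiniteDimensional K W'] {z : R}
    (hz : z ∈ W * M * W') :
    ∃ G ≤ M, FiniteDimensional K G ∧
      Module.finrank K G ≤ Module.finrank K W * Module.finrank K W' ∧ z ∈ W * G * W' := by
  obtain ⟨y, hy, rfl⟩ := exists_eq_sum_mul_finBasis K _ _ hz
  choose m hm hmy using fun a => exists_eq_sum_finBasis_mul K W M (hy a)
  refine ⟨Submodule.span K (Set.range fun p : _ × _ => m p.2 p.1), ?_,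
    FiniteDimensional.span_of_finite K (Set.finite_range _), ?_, ?_⟩
  · rw [Submodule.span_le]
    rintro _ ⟨p, rfl⟩
    exact hm _ _
  · exact (finrank_range_le_card _).trans (by simp)
  · refine Submodule.sum_mem _ fun a _ => Submodule.mul_mem_mul ?_ (Subtype.property _)
    rw [hmy a]
    exact Submodule.sum_mem _ fun c _ => Submodule.mul_mem_mul (Subtype.property _)
      (Submodule.subset_span ⟨(c, a), rfl⟩)

theorem Adeg_zero : Adeg K 0 = 1 := by
  rw [Adeg, Submodule.one_eq_span]
  congr 1
  ext z
  simp [Mon]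

theorem Adeg_mul (a b : ℕ) : Adeg K a * Adeg K b = Adeg K (a + b) := by
  rw [Adeg, Adeg, Adeg, Submodule.span_mul_span]
  congr 1
  ext z
  simp only [Set.mem_mul, Mon, Set.mem_ofPred_eq]
  constructor
  · rintro ⟨_, ⟨w, rfl, rfl⟩, _, ⟨w', rfl, rfl⟩, rfl⟩
    exact ⟨w ++ w', by simp, by simp⟩
  · rintro ⟨w, hw, rfl⟩
    refine ⟨_, ⟨w.take a, by simp; omega, rfl⟩, _, ⟨w.drop a, by simp; omega, rfl⟩, ?_⟩
    rw [← List.prod_append, ← List.map_append, List.take_append_drop]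

theorem Adeg_one : Adeg K 1 = Submodule.span K {FreeAlgebra.ι K 0, FreeAlgebra.ι K 1} := by
  rw [Adeg]
  congr 1
  ext z
  simp only [Mon, List.length_eq_one_iff, Set.mem_ofPred_eq, Set.mem_insert_iff,
    Set.mem_singleton_iff]
  constructor
  · rintro ⟨_, ⟨a, rfl⟩, rfl⟩
    fin_cases a <;> simp
  · rintro (rfl | rfl)
    · exact ⟨_, ⟨0, rfl⟩, by simp⟩
    · exact ⟨_, ⟨1, rfl⟩, by simp⟩

theorem finrank_Adeg_one : Module.finrank K (Adeg K 1) = 2 := by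
  have h : LinearIndependent K (FreeAlgebra.ι K : Fin 2 → FA K) := by
    refine LinearIndependent.of_comp
      (FreeAlgebra.lift K fun a => (Pi.single a 1 : Fin 2 → K)).toLinearMap ?_
    have h1 := Pi.linearIndependent_single_one (Fin 2) K
    rw [show (fun a : Fin 2 => (Pi.single a 1 : Fin 2 → K)) =
      (FreeAlgebra.lift K fun a => (Pi.single a 1 : Fin 2 → K)) ∘ FreeAlgebra.ι K by
        ext a : 1; simp] at h1
    exact h1
  have h2 := finrank_span_eq_card h
  rwa [Fintype.card_fin, show Set.range (FreeAlgebra.ι K : Fin 2 → FA K) =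
    {FreeAlgebra.ι K 0, FreeAlgebra.ι K 1} by ext z; simp [eq_comm], ← Adeg_one] at h2

theorem exists_mem_Adeg_ne_zero (k : ℕ) : ∃ z ∈ Adeg K k, z ≠ 0 := by
  refine ⟨((List.replicate k 0).map (FreeAlgebra.ι K)).prod,
    Submodule.subset_span ⟨_, List.length_replicate, rfl⟩, fun h => ?_⟩
  simpa using congrArg (FreeAlgebra.lift K (fun _ : Fin 2 => (1 : K))) h

theorem two_pow_add_mod_two_pow {a p q : ℕ} (h : q ≤ p) : (2 ^ p + a) % 2 ^ q = a % 2 ^ q := by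
  obtain ⟨c, rfl⟩ := Nat.exists_eq_add_of_le h
  simp [pow_add]

theorem lt_of_testBit_of_lt {a p q : ℕ} (ha : a < 2 ^ p) (hq : a.testBit q) : q < p := by
  by_contra! h
  rw [Nat.testBit_lt_two_pow (ha.trans_le (Nat.pow_le_pow_right two_pos h))] at hq
  simp at hq

theorem mod_two_pow_add_two_pow_le {a q : ℕ} (hq : a.testBit q) : a % 2 ^ q + 2 ^ q ≤ a := by
  have h1 := Nat.ge_two_pow_of_testBit hq
  have h2 := Nat.div_add_mod a (2 ^ q)
  have h3 : 1 ≤ a / 2 ^ q := (Nat.one_le_div_iff (by positivity)).2 h1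
  nlinarith [Nat.mul_le_mul_left (2 ^ q) h3]

theorem Ult_mul_Adeg_le (U : ℕ → Submodule K (FA K)) {a p : ℕ} (ha : a < 2 ^ p) :
    Ult K U a * Adeg K (2 ^ p) ≤ Ult K U (2 ^ p + a) := by
  simp only [Ult, Submodule.iSup_mul]
  refine iSup₂_le fun q hq => ?_
  have hqp := lt_of_testBit_of_lt ha hq
  have h := mod_two_pow_add_two_pow_le hq
  refine le_trans (le_of_eq ?_) (le_iSup₂ q (by rwa [Nat.testBit_two_pow_add_gt hqp]))
  rw [two_pow_add_mod_two_pow hqp.le, mul_assoc, Adeg_mul]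
  congr 2
  omega

theorem Adeg_mul_Ugt_le (U : ℕ → Submodule K (FA K)) {a p : ℕ} (ha : a < 2 ^ p) :
    Adeg K (2 ^ p) * Ugt K U a ≤ Ugt K U (2 ^ p + a) := by
  simp only [Ugt, Submodule.mul_iSup]
  refine iSup₂_le fun q hq => ?_
  have hqp := lt_of_testBit_of_lt ha hq
  have h := mod_two_pow_add_two_pow_le hq
  refine le_trans (le_of_eq ?_) (le_iSup₂ q (by rwa [Nat.testBit_two_pow_add_gt hqp]))
  rw [two_pow_add_mod_two_pow hqp.le, ← mul_assoc, ← mul_assoc, Adeg_mul]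
  congr 3
  omega

theorem Adeg_mul_le_Ult (U : ℕ → Submodule K (FA K)) {a p : ℕ} (ha : a < 2 ^ p) :
    Adeg K a * U p ≤ Ult K U (2 ^ p + a) := by
  refine le_trans (le_of_eq ?_) (le_iSup₂ p
    (by simp [Nat.testBit_two_pow_add_eq, Nat.testBit_lt_two_pow ha]))
  rw [two_pow_add_mod_two_pow le_rfl, Nat.mod_eq_of_lt ha,
    show 2 ^ p + a - a - 2 ^ p = 0 by omega, Adeg_zero, mul_one]

theorem mul_Adeg_le_Ugt (U : ℕ → Submodule K (FA K)) {a p : ℕ} (ha : a < 2 ^ p) :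
    U p * Adeg K a ≤ Ugt K U (2 ^ p + a) := by
  refine le_trans (le_of_eq ?_) (le_iSup₂ p
    (by simp [Nat.testBit_two_pow_add_eq, Nat.testBit_lt_two_pow ha]))
  rw [two_pow_add_mod_two_pow le_rfl, Nat.mod_eq_of_lt ha,
    show 2 ^ p + a - a - 2 ^ p = 0 by omega, Adeg_zero, one_mul]

/-- The product of `g p` over the set bits `p < N` of `i`. -/
def bitProd (g : ℕ → ℕ) (N i : ℕ) : ℕ :=
  ∏ p ∈ Finset.range N, if i.testBit p then g p else 1

theorem bitProd_succ_of_lt (g : ℕ → ℕ) {N i : ℕ} (hi : i < 2 ^ N) :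
    bitProd g (N + 1) i = bitProd g N i := by
  simp [bitProd, Finset.prod_range_succ, Nat.testBit_lt_two_pow hi]

theorem bitProd_two_pow_add (g : ℕ → ℕ) {N i : ℕ} (hi : i < 2 ^ N) :
    bitProd g (N + 1) (2 ^ N + i) = bitProd g N i * g N := by
  simp only [bitProd, Finset.prod_range_succ, Nat.testBit_two_pow_add_eq,
    Nat.testBit_lt_two_pow hi]
  simp only [Bool.not_false, if_true]
  congr 1
  refine Finset.prod_congr rfl fun p hp => ?_
  rw [Nat.testBit_two_pow_add_gt (Finset.mem_range.1 hp)]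

/-- `A(i)` is spanned, modulo `U^<(i)`, by a space of dimension at most `dim V^<(i)`. -/
theorem exists_complement_Ult (U V : ℕ → Submodule K (FA K)) (N : ℕ)
    (hUV : ∀ p < N, V p ⊔ U p = Adeg K (2 ^ p)) (hV : ∀ p < N, FiniteDimensional K (V p))
    (i : ℕ) (hi : i < 2 ^ N) :
    ∃ W ≤ Adeg K i, FiniteDimensional K W ∧
      Module.finrank K W ≤ bitProd (fun p => Module.finrank K (V p)) N i ∧
      Adeg K i ≤ W ⊔ Ult K U i := by
  induction N generalizing i with
  | zero =>
    obtain rfl : i = 0 := by simpa using hi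
    refine ⟨1, (Adeg_zero K).ge, ?_, ?_, (Adeg_zero K).le.trans le_sup_left⟩
    · rw [Submodule.one_eq_span]
      infer_instance
    · rw [Submodule.one_eq_span]
      simpa [bitProd] using finrank_span_le_card (R := K) ({1} : Set (FA K))
  | succ N ih =>
    have ih := ih (fun p hp => hUV p (hp.trans N.lt_succ_self))
      (fun p hp => hV p (hp.trans N.lt_succ_self))
    by_cases hiN : i < 2 ^ N
    · simpa only [bitProd_succ_of_lt _ hiN] using ih i hiN
    obtain ⟨a, rfl⟩ := Nat.exists_eq_add_of_le (not_lt.1 hiN)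
    have ha : a < 2 ^ N := by rw [pow_succ] at hi; omega
    obtain ⟨W, hWA, hWf, hWd, hW⟩ := ih a ha
    have := hV N N.lt_succ_self
    have hUVN := hUV N N.lt_succ_self
    have hVA : V N ≤ Adeg K (2 ^ N) := hUVN ▸ le_sup_left
    obtain ⟨hf, hd⟩ := finite_and_finrank_mul_le K W (V N)
    refine ⟨W * V N, ?_, hf, ?_, ?_⟩
    · rw [add_comm, ← Adeg_mul]
      exact mul_le_mul' hWA hVA
    · rw [bitProd_two_pow_add _ ha]
      exact hd.trans (Nat.mul_le_mul_right _ hWd)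
    · calc Adeg K (2 ^ N + a) = Adeg K a * Adeg K (2 ^ N) := by rw [Adeg_mul, add_comm]
        _ ≤ (W ⊔ Ult K U a) * Adeg K (2 ^ N) := mul_le_mul_left hW _
        _ = W * V N ⊔ W * U N ⊔ Ult K U a * Adeg K (2 ^ N) := by
          rw [Submodule.sup_mul, ← hUVN, Submodule.mul_sup W]
        _ ≤ _ := sup_le (sup_le le_sup_left (le_sup_of_le_right
          ((mul_le_mul_left hWA _).trans (Adeg_mul_le_Ult K U ha))))
          (le_sup_of_le_right (Ult_mul_Adeg_le K U ha))

/-- `A(i)` is spanned, modulo `U^>(i)`, by a space of dimension at most `dim V^>(i)`. -/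
theorem exists_complement_Ugt (U V : ℕ → Submodule K (FA K)) (N : ℕ)
    (hUV : ∀ p < N, V p ⊔ U p = Adeg K (2 ^ p)) (hV : ∀ p < N, FiniteDimensional K (V p))
    (i : ℕ) (hi : i < 2 ^ N) :
    ∃ W ≤ Adeg K i, FiniteDimensional K W ∧
      Module.finrank K W ≤ bitProd (fun p => Module.finrank K (V p)) N i ∧
      Adeg K i ≤ W ⊔ Ugt K U i := by
  induction N generalizing i with
  | zero =>
    obtain rfl : i = 0 := by simpa using hi
    refine ⟨1, (Adeg_zero K).ge, ?_, ?_, (Adeg_zero K).le.trans le_sup_left⟩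
    · rw [Submodule.one_eq_span]
      infer_instance
    · rw [Submodule.one_eq_span]
      simpa [bitProd] using finrank_span_le_card (R := K) ({1} : Set (FA K))
  | succ N ih =>
    have ih := ih (fun p hp => hUV p (hp.trans N.lt_succ_self))
      (fun p hp => hV p (hp.trans N.lt_succ_self))
    by_cases hiN : i < 2 ^ N
    · simpa only [bitProd_succ_of_lt _ hiN] using ih i hiN
    obtain ⟨a, rfl⟩ := Nat.exists_eq_add_of_le (not_lt.1 hiN)
    have ha : a < 2 ^ N := by rw [pow_succ] at hi; omega
    obtain ⟨W, hWA, hWf, hWd, hW⟩ := ih a ha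
    have := hV N N.lt_succ_self
    have hUVN := hUV N N.lt_succ_self
    have hVA : V N ≤ Adeg K (2 ^ N) := hUVN ▸ le_sup_left
    obtain ⟨hf, hd⟩ := finite_and_finrank_mul_le K (V N) W
    refine ⟨V N * W, ?_, hf, ?_, ?_⟩
    · rw [← Adeg_mul]
      exact mul_le_mul' hVA hWA
    · rw [bitProd_two_pow_add _ ha, mul_comm]
      exact hd.trans (Nat.mul_le_mul_left _ hWd)
    · calc Adeg K (2 ^ N + a) = Adeg K (2 ^ N) * Adeg K a := by rw [Adeg_mul]
        _ ≤ Adeg K (2 ^ N) * (W ⊔ Ugt K U a) := mul_le_mul_right hW _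
        _ = V N * W ⊔ U N * W ⊔ Adeg K (2 ^ N) * Ugt K U a := by
          rw [Submodule.mul_sup, ← hUVN, Submodule.sup_mul _ _ W]
        _ ≤ _ := sup_le (sup_le le_sup_left (le_sup_of_le_right
          ((mul_le_mul_right hWA _).trans (mul_Adeg_le_Ugt K U ha))))
          (le_sup_of_le_right (Adeg_mul_Ugt_le K U ha))

/-- A homogeneous element of degree `k` with `k = i + 2 ^ n + i'` lies in `A(i) G A(i')` modulo
`U^<(i)` and `U^>(i')`, for a small space `G ≤ A(2^n)`. -/
theorem exists_middle_space (U V : ℕ → Submodule K (FA K)) (N : ℕ)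
    (hUV : ∀ p < N, V p ⊔ U p = Adeg K (2 ^ p)) (hV : ∀ p < N, FiniteDimensional K (V p))
    {i c i' : ℕ} (hi : i < 2 ^ N) (hi' : i' < 2 ^ N) {z : FA K}
    (hz : z ∈ Adeg K (i + c + i')) :
    ∃ G ≤ Adeg K c, FiniteDimensional K G ∧
      Module.finrank K G ≤ bitProd (fun p => Module.finrank K (V p)) N i *
        bitProd (fun p => Module.finrank K (V p)) N i' ∧
      z ∈ Adeg K i * G * Adeg K i' ⊔ Ult K U i * Adeg K (c + i') ⊔
        Adeg K (i + c) * Ugt K U i' := by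
  obtain ⟨W, hWA, hWf, hWd, hW⟩ := exists_complement_Ult K U V N hUV hV i hi
  obtain ⟨W', hWA', hWf', hWd', hW'⟩ := exists_complement_Ugt K U V N hUV hV i' hi'
  have h : Adeg K (i + c + i') ≤
      W * Adeg K c * W' ⊔ (Ult K U i * Adeg K (c + i') ⊔ Adeg K (i + c) * Ugt K U i') := by
    calc Adeg K (i + c + i') = Adeg K i * Adeg K (c + i') := by rw [Adeg_mul, add_assoc]
      _ ≤ (W ⊔ Ult K U i) * Adeg K (c + i') := mul_le_mul_left hW _
      _ = W * Adeg K c * Adeg K i' ⊔ Ult K U i * Adeg K (c + i') := by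
        rw [Submodule.sup_mul, ← Adeg_mul K c i', ← mul_assoc, ← mul_assoc]
      _ ≤ W * Adeg K c * (W' ⊔ Ugt K U i') ⊔ Ult K U i * Adeg K (c + i') :=
        sup_le_sup_right (mul_le_mul_right hW' _) _
      _ = W * Adeg K c * W' ⊔ W * Adeg K c * Ugt K U i' ⊔ Ult K U i * Adeg K (c + i') := by
        rw [Submodule.mul_sup]
      _ ≤ _ := by
        refine sup_le (sup_le le_sup_left ?_) (le_sup_of_le_right le_sup_left)
        refine le_sup_of_le_right (le_sup_of_le_right ?_)
        rw [← Adeg_mul K i c]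
        exact mul_le_mul_left (mul_le_mul_left hWA _) _
  obtain ⟨y, hy, u, hu, rfl⟩ := Submodule.mem_sup.1 (h hz)
  obtain ⟨G, hGA, hGf, hGd, hyG⟩ := exists_le_finrank_le_mem_mul_mul K W _ W' hy
  refine ⟨G, hGA, hGf, hGd.trans (Nat.mul_le_mul hWd hWd'), ?_⟩
  rw [sup_assoc]
  exact Submodule.add_mem_sup (mul_le_mul' (mul_le_mul_left hWA _) hWA' hyG) hu

/-- A finite supremum of spaces of dimension at most `B`. -/
theorem finite_and_finrank_biSup_le {M ι : Type*} [AddCommGroup M] [Module K M] (s : Finset ι)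
    (G : ι → Submodule K M) (B : ℕ) (hf : ∀ a ∈ s, FiniteDimensional K (G a))
    (hB : ∀ a ∈ s, Module.finrank K (G a) ≤ B) :
    FiniteDimensional K ↥(s.sup G) ∧ Module.finrank K ↥(s.sup G) ≤ s.card * B := by
  induction s using Finset.induction_on with
  | empty => exact ⟨inferInstanceAs (FiniteDimensional K (⊥ : Submodule K M)),
      (finrank_bot K M).trans_le (Nat.zero_le _)⟩
  | insert a s ha ih =>
    obtain ⟨h1, h2⟩ := ih (fun b hb => hf b (Finset.mem_insert_of_mem hb))
      (fun b hb => hB b (Finset.mem_insert_of_mem hb))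
    have := hf a (Finset.mem_insert_self _ _)
    rw [Finset.sup_insert, Finset.card_insert_of_notMem ha]
    refine ⟨inferInstance, ?_⟩
    have h3 := Submodule.finrank_add_le_finrank_add_finrank (G a) (s.sup G)
    have h4 := hB a (Finset.mem_insert_self _ _)
    linarith

theorem sum_testBit_two_pow (i N : ℕ) :
    (∑ q ∈ Finset.range N, if i.testBit q then 2 ^ q else 0) = i % 2 ^ N := by
  induction N with
  | zero => simp [Nat.mod_one]
  | succ N ih =>
    rw [Finset.sum_range_succ, ih, Nat.mod_pow_succ, Nat.testBit_eq_decide_div_mod_eq]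
    rcases Nat.mod_two_eq_zero_or_one (i / 2 ^ N) with h | h <;> simp [h]

/-- When `g (c + q) = 2 ^ 2 ^ q` on the high bits, these contribute at most `2 ^ (i / 2 ^ c)`. -/
theorem bitProd_add_le (g : ℕ → ℕ) (c L i : ℕ) (hlow : ∀ p < c, 1 ≤ g p)
    (hhigh : ∀ q < L, g (c + q) = 2 ^ 2 ^ q) :
    bitProd g (c + L) i ≤ (∏ p ∈ Finset.range c, g p) * 2 ^ (i / 2 ^ c) := by
  rw [bitProd, Finset.prod_range_add]
  refine Nat.mul_le_mul (Finset.prod_le_prod' fun p hp => ?_) ?_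
  · have := hlow p (Finset.mem_range.1 hp)
    split_ifs <;> simp [this]
  · have h : ∀ q ∈ Finset.range L, (if i.testBit (c + q) then g (c + q) else 1) =
        2 ^ (if (i / 2 ^ c).testBit q then 2 ^ q else 0) := by
      intro q hq
      rw [hhigh q (Finset.mem_range.1 hq), Nat.testBit_div_two_pow, add_comm q]
      split_ifs <;> simp
    rw [Finset.prod_congr rfl h, Finset.prod_pow_eq_pow_sum, sum_testBit_two_pow]
    exact Nat.pow_le_pow_right two_pos (Nat.mod_le _ _)

theorem bitProd_mul_bitProd_le (g : ℕ → ℕ) (c L i i' T : ℕ) (hlow : ∀ p < c, 1 ≤ g p)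
    (hhigh : ∀ q < L, g (c + q) = 2 ^ 2 ^ q) (hT : i + i' ≤ 2 ^ c * T) :
    bitProd g (c + L) i * bitProd g (c + L) i' ≤ (∏ p ∈ Finset.range c, g p) ^ 2 * 2 ^ T := by
  refine (Nat.mul_le_mul (bitProd_add_le g c L i hlow hhigh)
    (bitProd_add_le g c L i' hlow hhigh)).trans ?_
  have h : i / 2 ^ c + i' / 2 ^ c ≤ T :=
    Nat.div_add_div_le_add_div.trans (Nat.div_le_of_le_mul hT)
  calc _ = (∏ p ∈ Finset.range c, g p) ^ 2 * 2 ^ (i / 2 ^ c + i' / 2 ^ c) := by ring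
    _ ≤ _ := Nat.mul_le_mul_left _ (Nat.pow_le_pow_right two_pos h)

theorem sum_window_two_pow_le (c s l : ℕ) :
    (∑ p ∈ Finset.range c, if s ≤ p ∧ p ≤ s + l then 2 ^ (p - s) else 0) ≤ 2 ^ (l + 1) := by
  rw [← Finset.sum_filter]
  calc _ ≤ ∑ p ∈ Finset.Ico s (s + l + 1), 2 ^ (p - s) :=
        Finset.sum_le_sum_of_subset fun p hp => by
          simp only [Finset.mem_filter, Finset.mem_Ico] at hp ⊢
          omega
    _ = ∑ q ∈ Finset.range (l + 1), 2 ^ q := by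
        rw [Finset.sum_Ico_eq_sum_range]
        simp [add_assoc]
    _ ≤ _ := (Nat.geomSum_lt le_rfl (by simp)).le

/-- The contribution of the positions below `c`, each of which either carries the value `2` or
lies in the window attached to some `k ∈ Y`, `k < n`. -/
theorem prod_sq_le_of_windows (Y : Set ℕ) (e g : ℕ → ℕ) (c n : ℕ)
    (hg : ∀ p < c, g p = 2 ∨ ∃ k ∈ Y, k < n ∧ ∃ j ≤ e k, k - e k - 1 + j = p ∧ g p = 2 ^ 2 ^ j) :
    (∏ p ∈ Finset.range c, g p) ^ 2 ≤
      2 ^ (2 * c) * ∏ k ∈ Finset.range n, if k ∈ Y then 2 ^ 2 ^ (e k + 2) else 1 := by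
  set h : ℕ → ℕ → ℕ := fun k p => if k ∈ Y then
    2 ^ (if k - e k - 1 ≤ p ∧ p ≤ k - e k - 1 + e k then 2 ^ (p - (k - e k - 1)) else 0) else 1
    with hh
  have h1 : ∀ k p, 1 ≤ h k p := fun k p => by
    simp only [hh]
    split_ifs <;> simp [Nat.one_le_two_pow]
  have hle : ∀ p ∈ Finset.range c, g p ≤ 2 * ∏ k ∈ Finset.range n, h k p := by
    intro p hp
    have hone : 1 ≤ ∏ k ∈ Finset.range n, h k p := Finset.one_le_prod' fun k _ => h1 k p
    rcases hg p (Finset.mem_range.1 hp) with h2 | ⟨k, hkY, hkn, j, hj, rfl, h2⟩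
    · omega
    · have h3 : h k (k - e k - 1 + j) ≤ ∏ k' ∈ Finset.range n, h k' (k - e k - 1 + j) :=
        Finset.single_le_prod' (f := fun k' => h k' (k - e k - 1 + j)) (fun k' _ => h1 k' _)
          (Finset.mem_range.2 hkn)
      have h4 : h k (k - e k - 1 + j) = 2 ^ 2 ^ j := by
        simp only [hh, hkY, if_true]
        rw [if_pos ⟨by omega, by omega⟩, Nat.add_sub_cancel_left]
      omega
  have hcol : ∀ k, (∏ p ∈ Finset.range c, h k p) ^ 2 ≤
      if k ∈ Y then 2 ^ 2 ^ (e k + 2) else 1 := by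
    intro k
    by_cases hk : k ∈ Y
    · simp only [hh, hk, if_true]
      rw [Finset.prod_pow_eq_pow_sum, ← pow_mul]
      refine Nat.pow_le_pow_right two_pos ?_
      have := sum_window_two_pow_le c (k - e k - 1) (e k)
      rw [pow_succ 2 (e k + 1)]
      exact Nat.mul_le_mul_right 2 this
    · simp [hh, hk]
  calc (∏ p ∈ Finset.range c, g p) ^ 2
      ≤ (∏ p ∈ Finset.range c, 2 * ∏ k ∈ Finset.range n, h k p) ^ 2 :=
        Nat.pow_le_pow_left (Finset.prod_le_prod' hle) 2
    _ = 2 ^ (2 * c) * ∏ k ∈ Finset.range n, (∏ p ∈ Finset.range c, h k p) ^ 2 := by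
        rw [Finset.prod_mul_distrib, Finset.prod_comm, Finset.prod_pow, mul_pow, Finset.prod_const,
          Finset.card_range, ← pow_mul, mul_comm c]
    _ ≤ _ := Nat.mul_le_mul_left _ (Finset.prod_le_prod' fun k _ => hcol k)

/-- **Lemma 6.1.**  Construction of the auxiliary space `F'(2^n)`. -/
theorem statement17
    (ξ : ℕ) (f : Fin ξ → FA K) (d : Fin ξ → ℕ)
    (hpos : ∀ j, 1 ≤ d j) (hhom : ∀ j, f j ∈ Adeg K (d j))
    (r : ℕ → ℕ)
    (hr : ∀ i, r i = (Finset.univ.filter fun j => 2 ^ i < d j ∧ d j ≤ 2 ^ (i + 1)).card)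
    (Y : Set ℕ) (hYdef : Y = {i : ℕ | r i ≠ 0})
    (hdeg : ∀ j, ∃ n : ℕ, 2 ≤ n ∧ 2 ^ n + 2 ^ (n - 1) ≤ d j ∧
      d j ≤ 2 ^ n + 2 ^ (n - 1) + 2 ^ (n - 2))
    (e : ℕ → ℕ) (he : ∀ n ∈ Y, 1 ≤ e n ∧ e n ≤ n - 1)
    (hdisj : ∀ n ∈ Y, ∀ m ∈ Y, n ≠ m →
      Disjoint (Set.Icc (n - e n - 1) (n - 1)) (Set.Icc (m - e m - 1) (m - 1)))
    (hbound : ∀ n ∈ Y,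
      r n * 2 ^ (3 * n + 4) *
        (∏ k ∈ Finset.range n, if k ∈ Y then 2 ^ 2 ^ (e k + 2) else 1) ≤
      2 ^ 2 ^ (e n - 1))
    (n : ℕ) (hn : n ∈ Y)
    (F U V : ℕ → Submodule K (FA K))
    (hV0 : V 0 = Submodule.span K {FreeAlgebra.ι K 0, FreeAlgebra.ι K 1})
    (hU0 : U 0 = ⊥)
    (hconds : ∀ m, 1 ≤ m → m < n → Conds K Y e F U V m) :
    ∃ F' : Submodule K (FA K), F' ≤ Adeg K (2 ^ n) ∧
      -- `0 < dim F'(2^n) ≤ ½ (dim V(2^{n-1}))²`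
      F' ≠ ⊥ ∧ 2 * Module.rank K F' ≤ Module.rank K (V (n - 1)) ^ 2 ∧
      ∀ j : Fin ξ, 2 ^ n + 2 ^ (n - 1) ≤ d j → d j ≤ 2 ^ n + 2 ^ (n - 1) + 2 ^ (n - 2) →
        ∀ i i' : ℕ, i + i' = d j - 2 ^ n →
          f j ∈ Adeg K i * F' * Adeg K i' ⊔ Ult K U i * Adeg K (d j - i) ⊔
            Adeg K (d j - i') * Ugt K U i' := by
  obtain ⟨he1, hen⟩ := he n hn
  have hUV : ∀ p < n, V p ⊔ U p = Adeg K (2 ^ p) := by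
    intro p hp
    rcases Nat.eq_zero_or_pos p with rfl | hp0
    · rw [hV0, hU0, sup_bot_eq, pow_zero, Adeg_one]
    · exact (hconds p hp0 hp).2.2.2.2.2.2.1
  have hwindow : ∀ k ∈ Y, ∀ j ≤ e k, k - e k - 1 + j < n →
      Module.finrank K (V (k - e k - 1 + j)) = 2 ^ 2 ^ j := by
    intro k hk j hj hlt
    rcases Nat.eq_zero_or_pos (k - e k - 1 + j) with h0 | h0
    · obtain rfl : j = 0 := by omega
      rw [h0, hV0, ← Adeg_one, finrank_Adeg_one]
      norm_num
    · exact (hconds _ h0 hlt).2.1 k hk j hj rfl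
  have hout : ∀ p < n, p ∉ SetS Y e → Module.finrank K (V p) = 2 := by
    intro p hp hpS
    rcases Nat.eq_zero_or_pos p with rfl | hp0
    · rw [hV0, ← Adeg_one, finrank_Adeg_one]
    · exact (hconds p hp0 hp).1 hpS fun _ => ⟨n, hn, hp.le⟩
  set g : ℕ → ℕ := fun p => Module.finrank K (V p) with hg
  obtain ⟨c, hc⟩ : ∃ c, n = c + (e n + 1) := ⟨n - (e n + 1), by omega⟩
  have hhigh : ∀ q < e n + 1, g (c + q) = 2 ^ 2 ^ q := by
    intro q hq
    have := hwindow n hn q (by omega) (by omega)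
    rwa [show n - e n - 1 = c by omega] at this
  have hlow : ∀ p < c, g p = 2 ∨
      ∃ k ∈ Y, k < n ∧ ∃ j ≤ e k, k - e k - 1 + j = p ∧ g p = 2 ^ 2 ^ j := by
    intro p hp
    by_cases hpS : p ∈ SetS Y e
    · right
      simp only [SetS, Set.mem_iUnion, Set.mem_Icc] at hpS
      obtain ⟨k, hk, hk1, hk2⟩ := hpS
      obtain ⟨hek, hek'⟩ := he k hk
      refine ⟨k, hk, ?_, p - (k - e k - 1), by omega, by omega, ?_⟩
      · by_contra! hnk
        have hne : n ≠ k := by rintro rfl; omega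
        have hnS : n - 1 ∈ Set.Icc (n - e n - 1) (n - 1) := ⟨by omega, le_rfl⟩
        exact Set.disjoint_left.1 (hdisj n hn k hk hne) hnS ⟨by omega, by omega⟩
      · have := hwindow k hk (p - (k - e k - 1)) (by omega) (by omega)
        rwa [show k - e k - 1 + (p - (k - e k - 1)) = p by omega] at this
    · exact Or.inl (hout p (by omega) hpS)
  have hlow1 : ∀ p < c, 1 ≤ g p := by
    intro p hp
    rcases hlow p hp with h | ⟨k, -, -, j, -, -, h⟩
    · omega
    · rw [h]; exact Nat.one_le_two_pow
  have hfin : ∀ p < n, FiniteDimensional K (V p) := by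
    intro p hp
    apply Module.finite_of_finrank_pos
    by_cases hpc : p < c
    · exact hlow1 p hpc
    · have := hhigh (p - c) (by omega)
      rw [show c + (p - c) = p by omega] at this
      exact Nat.lt_of_lt_of_eq (Nat.two_pow_pos _) this.symm
  set Q := ∏ k ∈ Finset.range n, if k ∈ Y then 2 ^ 2 ^ (e k + 2) else 1 with hQ
  set T := 2 ^ e n + 2 ^ (e n - 1) with hT
  have hpow : 2 ^ (n - 1) + 2 ^ (n - 2) = 2 ^ c * T := by
    rw [hT, mul_add, ← pow_add, ← pow_add]
    congr 2 <;> omega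
  have hpown : 2 ^ (n - 1) + 2 ^ (n - 2) < 2 ^ n := by
    obtain ⟨b, rfl⟩ : ∃ b, n = b + 2 := ⟨n - 2, by omega⟩
    have := Nat.two_pow_pos b
    simp only [Nat.add_sub_cancel, show b + 2 - 1 = b + 1 by omega, pow_succ]
    omega
  set B := 2 ^ (2 * c) * Q * 2 ^ T with hB
  have hBle : ∀ i i', i + i' ≤ 2 ^ c * T → bitProd g n i * bitProd g n i' ≤ B := by
    intro i i' hii
    have h1 := bitProd_mul_bitProd_le g c (e n + 1) i i' T hlow1 hhigh hii
    rw [← hc] at h1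
    exact h1.trans (Nat.mul_le_mul_right _ (prod_sq_le_of_windows Y e g c n hlow))
  have hex : ∀ p : Fin ξ × ℕ, ∃ G ≤ Adeg K (2 ^ n), FiniteDimensional K G ∧
      Module.finrank K G ≤ B ∧
      (2 ^ n + 2 ^ (n - 1) ≤ d p.1 → d p.1 ≤ 2 ^ n + 2 ^ (n - 1) + 2 ^ (n - 2) →
        ∀ i', p.2 + i' = d p.1 - 2 ^ n →
          f p.1 ∈ Adeg K p.2 * G * Adeg K i' ⊔ Ult K U p.2 * Adeg K (d p.1 - p.2) ⊔
            Adeg K (d p.1 - i') * Ugt K U i') := by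
    rintro ⟨j, i⟩
    by_cases hcond : 2 ^ n + 2 ^ (n - 1) ≤ d j ∧ d j ≤ 2 ^ n + 2 ^ (n - 1) + 2 ^ (n - 2) ∧
      i ≤ d j - 2 ^ n
    · obtain ⟨h1, h2, h3⟩ := hcond
      obtain ⟨i', hi'⟩ := Nat.exists_eq_add_of_le h3
      have hpos' := Nat.two_pow_pos (n - 1)
      have hdj : d j = i + 2 ^ n + i' := by omega
      obtain ⟨G, hGA, hGf, hGd, hGm⟩ := exists_middle_space K U V n hUV hfin (i := i)
        (c := 2 ^ n) (i' := i') (by omega) (by omega) (hdj ▸ hhom j)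
      refine ⟨G, hGA, hGf, hGd.trans (hBle i i' (by omega)), fun _ _ i'' hi'' => ?_⟩
      obtain rfl : i'' = i' := by simp only at hi''; omega
      rwa [show d j - i = 2 ^ n + i'' by omega, show d j - i'' = i + 2 ^ n by omega]
    · refine ⟨⊥, bot_le, inferInstance, by simp, fun h1 h2 i' hi' => ?_⟩
      exact (hcond ⟨h1, h2, by simp only at hi'; omega⟩).elim
  choose G hGA hGf hGd hGm using hex
  set s := (Finset.univ.filter fun j => 2 ^ n < d j ∧ d j ≤ 2 ^ (n + 1)) ×ˢ Finset.range (2 ^ n)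
    with hs
  obtain ⟨hsf, hsd⟩ := finite_and_finrank_biSup_le K s G B (fun a _ => hGf a) fun a _ => hGd a
  obtain ⟨z, hz, hz0⟩ := exists_mem_Adeg_ne_zero K (2 ^ n)
  have hzle : Submodule.span K {z} ≤ Adeg K (2 ^ n) :=
    (Submodule.span_singleton_le_iff_mem _ _).2 hz
  refine ⟨s.sup G ⊔ Submodule.span K {z}, sup_le (Finset.sup_le fun a _ => hGA a) hzle,
    fun h => hz0 ?_, ?_, ?_⟩
  · have : z ∈ s.sup G ⊔ Submodule.span K {z} :=
      Submodule.mem_sup_right (Submodule.mem_span_singleton_self z)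
    rwa [h, Submodule.mem_bot] at this
  · have hfinV := hfin (n - 1) (by omega)
    rw [← Module.finrank_eq_rank, ← Module.finrank_eq_rank]
    have hVn : Module.finrank K (V (n - 1)) = 2 ^ 2 ^ e n := by
      have := hhigh (e n) (by omega)
      rwa [show c + e n = n - 1 by omega] at this
    rw [hVn]
    have h1 := Submodule.finrank_add_le_finrank_add_finrank (s.sup G) (Submodule.span K {z})
    have h2 : Module.finrank K (Submodule.span K {z}) = 1 := finrank_span_singleton hz0
    have h3 : s.card = r n * 2 ^ n := by
      rw [hs, Finset.card_product, Finset.card_range, hr]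
    have h4 : 16 * (s.card * B) ≤ (2 ^ 2 ^ e n) ^ 2 := by
      calc 16 * (s.card * B) = r n * 2 ^ (n + 2 * c + 4) * Q * 2 ^ T := by
            rw [h3, hB]; ring
        _ ≤ r n * 2 ^ (3 * n + 4) * Q * 2 ^ T := by
            gcongr
            · norm_num
            · omega
        _ ≤ 2 ^ 2 ^ (e n - 1) * 2 ^ T := Nat.mul_le_mul_right _ (hbound n hn)
        _ = (2 ^ 2 ^ e n) ^ 2 := by
            obtain ⟨b, hb⟩ : ∃ b, e n = b + 1 := ⟨e n - 1, by omega⟩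
            rw [hT, hb, Nat.add_sub_cancel]
            ring
    have h5 : 4 ≤ 2 ^ 2 ^ e n := by
      calc 4 = 2 ^ 2 ^ 1 := by norm_num
        _ ≤ _ := Nat.pow_le_pow_right two_pos (Nat.pow_le_pow_right two_pos he1)
    have h6 : 2 * Module.finrank K ↥(s.sup G ⊔ Submodule.span K {z}) ≤ (2 ^ 2 ^ e n) ^ 2 := by
      nlinarith
    exact_mod_cast h6
  · intro j hj1 hj2 i i' hii
    have hmem : (j, i) ∈ s := by
      have := Nat.two_pow_pos (n - 1)
      simp only [hs, Finset.mem_product, Finset.mem_filter, Finset.mem_univ, true_and,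
        Finset.mem_range, pow_succ]
      omega
    have hle : G (j, i) ≤ s.sup G ⊔ Submodule.span K {z} :=
      (Finset.le_sup (f := G) hmem).trans le_sup_left
    exact sup_le_sup_right (sup_le_sup_right
      (mul_le_mul_left (mul_le_mul_right hle _) _) _) _ (hGm (j, i) hj1 hj2 i' hii)

end
end
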